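/- The function φ defined on (1/√2, 1) by φ(k) = H(k)/K(k) is continuous and strictly decreasing on (1/√2, 1); moreover φ(k) → 1 as k → (1/√2)⁺ and φ(k) → 0 as k → 1⁻, so that the image φ((1/√2, 1)) equals the whole interval (0, 1). -/

import Mathlib

open Real Filter Set

/-- Complete elliptic integral of the first kind. -/
noncomputable def Kell (k : ℝ) : ℝ :=
  ∫ t in (0:ℝ)..1, 1 / Real.sqrt ((1 - t^2) * (1 - k^2 * t^2))

/-- S(k) = 4√(2k²−1)·K(k). -/
noncomputable def Sfun (k : ℝ) : ℝ := 4 * Real.sqrt (2 * k^2 - 1) * Kell k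

/-- H(k), the numerator in the definition of φ. -/
noncomputable def Hfun (k : ℝ) : ℝ :=
  ∫ t in Real.sqrt ((2 * k^2 - 1) / k^2)..1,
    1 / Real.sqrt ((1 - t^2) * (1 - k^2 * (1 - t^2)))

/-- φ(k) = H(k)/K(k). -/
noncomputable def phiFun (k : ℝ) : ℝ := Hfun k / Kell k

/-- ξ_n = 2|αn − ⌊αn + 1/2⌋|. -/
noncomputable def xiSeq (α : ℝ) (n : ℕ) : ℝ :=
  2 * |α * n - (⌊α * n + 1/2⌋ : ℝ)|

/-- The integrand of the incomplete elliptic integral of the first kind in trigonometric form. -/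
noncomputable def ellIntegrand (k x : ℝ) : ℝ := 1 / √(1 - k ^ 2 * sin x ^ 2)

/-- The incomplete elliptic integral of the first kind. -/
noncomputable def incompleteEll (k θ : ℝ) : ℝ := ∫ x in (0 : ℝ)..θ, ellIntegrand k x

/-- The amplitude with `Hfun k = incompleteEll k (ellAmplitude k)`. -/
noncomputable def ellAmplitude (k : ℝ) : ℝ := arccos √((2 * k ^ 2 - 1) / k ^ 2)

lemma one_sub_sq_mul_sin_sq_pos {k : ℝ} (hk : k ∈ Ioo 0 1) (x : ℝ) :
    0 < 1 - k ^ 2 * sin x ^ 2 := by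
  have h1 : k ^ 2 < 1 := by nlinarith [hk.1, hk.2]
  nlinarith [sin_sq_le_one x, sq_nonneg (sin x), sq_nonneg k]

lemma ellIntegrand_pos {k : ℝ} (hk : k ∈ Ioo 0 1) (x : ℝ) : 0 < ellIntegrand k x :=
  one_div_pos.2 (sqrt_pos.2 (one_sub_sq_mul_sin_sq_pos hk x))

lemma one_le_ellIntegrand {k : ℝ} (hk : k ∈ Ioo 0 1) (x : ℝ) : 1 ≤ ellIntegrand k x := by
  rw [ellIntegrand, le_div_iff₀ (sqrt_pos.2 (one_sub_sq_mul_sin_sq_pos hk x)), one_mul]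
  exact sqrt_le_one.2 (by nlinarith [mul_nonneg (sq_nonneg k) (sq_nonneg (sin x))])

lemma continuous_ellIntegrand {k : ℝ} (hk : k ∈ Ioo 0 1) : Continuous (ellIntegrand k) := by
  unfold ellIntegrand
  exact continuous_const.div (by fun_prop)
    fun x => (sqrt_pos.2 (one_sub_sq_mul_sin_sq_pos hk x)).ne'

lemma intervalIntegrable_ellIntegrand {k : ℝ} (hk : k ∈ Ioo 0 1) (a b : ℝ) :
    IntervalIntegrable (ellIntegrand k) MeasureTheory.volume a b :=
  (continuous_ellIntegrand hk).intervalIntegrable a b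

lemma sin_image_Ioo : sin '' Ioo 0 (π / 2) = Ioo 0 1 := by
  ext y
  constructor
  · rintro ⟨x, hx, rfl⟩
    refine ⟨sin_pos_of_pos_of_lt_pi hx.1 (by linarith [hx.2, pi_pos]), ?_⟩
    rw [← sin_pi_div_two]
    exact sin_lt_sin_of_lt_of_le_pi_div_two (by linarith [hx.1, pi_pos]) le_rfl hx.2
  · intro hy
    exact ⟨arcsin y, ⟨arcsin_pos.2 hy.1, arcsin_lt_pi_div_two.2 hy.2⟩,
      sin_arcsin (by linarith [hy.1]) hy.2.le⟩

lemma cos_image_Ioo {c : ℝ} (hc : 0 ≤ c) (hc' : c ≤ 1) :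
    cos '' Ioo 0 (arccos c) = Ioo c 1 := by
  ext y
  constructor
  · rintro ⟨x, hx, rfl⟩
    have hxπ : x ≤ π := hx.2.le.trans (arccos_le_pi c)
    constructor
    · conv_lhs => rw [← cos_arccos (by linarith) hc']
      exact cos_lt_cos_of_nonneg_of_le_pi hx.1.le (arccos_le_pi c) hx.2
    · rw [← cos_zero]
      exact cos_lt_cos_of_nonneg_of_le_pi le_rfl hxπ hx.1
  · intro hy
    exact ⟨arccos y, ⟨arccos_pos.2 hy.2, arccos_lt_arccos (by linarith) hy.1 hy.2.le⟩,
      cos_arccos (by linarith [hy.1]) hy.2.le⟩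

lemma Kell_eq_incompleteEll (k : ℝ) : Kell k = incompleteEll k (π / 2) := by
  rw [Kell, incompleteEll, intervalIntegral.integral_of_le zero_le_one,
    intervalIntegral.integral_of_le (by positivity), MeasureTheory.integral_Ioc_eq_integral_Ioo,
    MeasureTheory.integral_Ioc_eq_integral_Ioo, ← sin_image_Ioo,
    MeasureTheory.integral_image_eq_integral_abs_deriv_smul measurableSet_Ioo
      (fun x _ => (hasDerivAt_sin x).hasDerivWithinAt)
      (injOn_sin.mono (Ioo_subset_Icc_self.trans (Icc_subset_Icc_left (by linarith [pi_pos]))))]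
  refine MeasureTheory.setIntegral_congr_fun measurableSet_Ioo fun x hx => ?_
  have hcos : 0 < cos x := cos_pos_of_mem_Ioo ⟨by linarith [hx.1, pi_pos], hx.2⟩
  simp only [ellIntegrand, smul_eq_mul]
  rw [← cos_sq', sqrt_mul (sq_nonneg _), sqrt_sq hcos.le, abs_of_pos hcos]
  field_simp

lemma sqrt_amplitude_lt_one {k : ℝ} (hk : k ∈ Ioo 0 1) : √((2 * k ^ 2 - 1) / k ^ 2) < 1 := by
  have h0 : 0 < k ^ 2 := pow_pos hk.1 2
  rw [sqrt_lt' one_pos, div_lt_iff₀ h0]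
  nlinarith [hk.1, hk.2]

lemma Hfun_eq_incompleteEll {k : ℝ} (hk : k ∈ Ioo 0 1) :
    Hfun k = incompleteEll k (ellAmplitude k) := by
  have hle := (sqrt_amplitude_lt_one hk).le
  rw [Hfun, incompleteEll, ellAmplitude, intervalIntegral.integral_of_le hle,
    intervalIntegral.integral_of_le (arccos_nonneg _), MeasureTheory.integral_Ioc_eq_integral_Ioo,
    MeasureTheory.integral_Ioc_eq_integral_Ioo, ← cos_image_Ioo (sqrt_nonneg _) hle,
    MeasureTheory.integral_image_eq_integral_abs_deriv_smul measurableSet_Ioo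
      (fun x _ => (hasDerivAt_cos x).hasDerivWithinAt)
      (injOn_cos.mono (Ioo_subset_Icc_self.trans (Icc_subset_Icc_right (arccos_le_pi _))))]
  refine MeasureTheory.setIntegral_congr_fun measurableSet_Ioo fun x hx => ?_
  have hsin : 0 < sin x :=
    sin_pos_of_pos_of_lt_pi hx.1 (hx.2.trans_le (arccos_le_pi _))
  simp only [ellIntegrand, smul_eq_mul]
  rw [← sin_sq, sqrt_mul (sq_nonneg _), sqrt_sq hsin.le, abs_neg, abs_of_pos hsin]
  field_simp

lemma phiFun_eq {k : ℝ} (hk : k ∈ Ioo 0 1) :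
    phiFun k = incompleteEll k (ellAmplitude k) / incompleteEll k (π / 2) := by
  rw [phiFun, Hfun_eq_incompleteEll hk, Kell_eq_incompleteEll]

lemma continuousAt_incompleteEll {k : ℝ} (hk : k ∈ Ioo 0 1) (θ : ℝ) :
    ContinuousAt (fun p : ℝ × ℝ => incompleteEll p.1 p.2) (k, θ) := by
  obtain ⟨c, hkc, hc⟩ := exists_between hk.2
  have hc0 : 0 < c := hk.1.trans hkc
  have hcc : 0 < 1 - c ^ 2 := by nlinarith
  have hcont : Continuous fun p : ℝ × ℝ =>
      ∫ x in (0 : ℝ)..p.2, 1 / √(max (1 - p.1 ^ 2 * sin x ^ 2) (1 - c ^ 2)) := by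
    refine intervalIntegral.continuous_parametric_intervalIntegral_of_continuous
      (f := fun (p : ℝ × ℝ) x => 1 / √(max (1 - p.1 ^ 2 * sin x ^ 2) (1 - c ^ 2)))
      (Continuous.div continuous_const ?_ ?_) continuous_snd
    · fun_prop
    · exact fun q => (sqrt_pos.2 (lt_max_of_lt_right hcc)).ne'
  refine hcont.continuousAt.congr ?_
  have hmem : ∀ᶠ p : ℝ × ℝ in nhds (k, θ), p.1 ∈ Ioo 0 c :=
    continuous_fst.continuousAt.eventually (Ioo_mem_nhds hk.1 hkc)
  filter_upwards [hmem] with p hp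
  refine intervalIntegral.integral_congr fun x _ => ?_
  have hpc : p.1 ^ 2 ≤ c ^ 2 := pow_le_pow_left₀ hp.1.le hp.2.le 2
  have hle : 1 - c ^ 2 ≤ 1 - p.1 ^ 2 * sin x ^ 2 := by
    nlinarith [sin_sq_le_one x, sq_nonneg p.1]
  simp only [ellIntegrand, max_eq_left hle]

lemma incompleteEll_strictMono {k : ℝ} (hk : k ∈ Ioo 0 1) : StrictMono (incompleteEll k) := by
  intro a b hab
  have h := intervalIntegral.integral_add_adjacent_intervals
    (intervalIntegrable_ellIntegrand hk 0 a) (intervalIntegrable_ellIntegrand hk a b)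
  have hpos : 0 < ∫ x in a..b, ellIntegrand k x :=
    intervalIntegral.intervalIntegral_pos_of_pos (intervalIntegrable_ellIntegrand hk a b)
      (ellIntegrand_pos hk) hab
  simp only [incompleteEll]
  linarith

lemma incompleteEll_pos {k θ : ℝ} (hk : k ∈ Ioo 0 1) (hθ : 0 < θ) : 0 < incompleteEll k θ := by
  simpa [incompleteEll] using incompleteEll_strictMono hk hθ

lemma le_incompleteEll {k θ : ℝ} (hk : k ∈ Ioo 0 1) (hθ : 0 ≤ θ) : θ ≤ incompleteEll k θ := by
  have h := intervalIntegral.integral_mono_on hθ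
    (intervalIntegrable_const (c := (1 : ℝ))) (intervalIntegrable_ellIntegrand hk 0 θ)
    fun x _ => one_le_ellIntegrand hk x
  simpa [incompleteEll] using h

lemma ellIntegrand_mul_le {k₁ k₂ x y : ℝ} (hk₁ : k₁ ∈ Ioo 0 1) (hk₂ : k₂ ∈ Ioo 0 1)
    (hk : k₁ ≤ k₂) (hx : 0 ≤ x) (hxy : x ≤ y) (hy : y ≤ π / 2) :
    ellIntegrand k₂ x * ellIntegrand k₁ y ≤ ellIntegrand k₂ y * ellIntegrand k₁ x := by
  have hsin : sin x ^ 2 ≤ sin y ^ 2 :=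
    pow_le_pow_left₀ (sin_nonneg_of_nonneg_of_le_pi hx (by linarith [pi_pos]))
      (sin_le_sin_of_le_of_le_pi_div_two (by linarith [pi_pos]) hy hxy) 2
  have hsq : k₁ ^ 2 ≤ k₂ ^ 2 := pow_le_pow_left₀ hk₁.1.le hk 2
  have p1 := one_sub_sq_mul_sin_sq_pos hk₂ y
  have p2 := one_sub_sq_mul_sin_sq_pos hk₁ x
  simp only [ellIntegrand, one_div_mul_one_div]
  rw [← sqrt_mul p1.le, ← sqrt_mul (one_sub_sq_mul_sin_sq_pos hk₂ x).le]
  refine one_div_le_one_div_of_le (sqrt_pos.2 (mul_pos p1 p2)) (sqrt_le_sqrt ?_)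
  nlinarith [mul_nonneg (sub_nonneg.2 hsin) (sub_nonneg.2 hsq)]

/-- For a fixed amplitude, the ratio of the incomplete to the complete integral decreases with
the modulus. -/
lemma incompleteEll_mul_le {k₁ k₂ θ : ℝ} (hk₁ : k₁ ∈ Ioo 0 1) (hk₂ : k₂ ∈ Ioo 0 1)
    (hk : k₁ ≤ k₂) (hθ : 0 ≤ θ) (hθ' : θ ≤ π / 2) :
    incompleteEll k₂ θ * incompleteEll k₁ (π / 2) ≤
      incompleteEll k₁ θ * incompleteEll k₂ (π / 2) := by
  have split : ∀ {k}, k ∈ Ioo (0 : ℝ) 1 →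
      incompleteEll k θ + (∫ x in θ..(π / 2), ellIntegrand k x) = incompleteEll k (π / 2) :=
    fun h => intervalIntegral.integral_add_adjacent_intervals
      (intervalIntegrable_ellIntegrand h 0 θ) (intervalIntegrable_ellIntegrand h θ _)
  have hA : incompleteEll k₂ θ * ellIntegrand k₁ θ ≤ ellIntegrand k₂ θ * incompleteEll k₁ θ := by
    rw [incompleteEll, incompleteEll, ← intervalIntegral.integral_mul_const,
      ← intervalIntegral.integral_const_mul]
    exact intervalIntegral.integral_mono_on hθ
      ((intervalIntegrable_ellIntegrand hk₂ 0 θ).mul_const _)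
      ((intervalIntegrable_ellIntegrand hk₁ 0 θ).const_mul _)
      fun x hx => ellIntegrand_mul_le hk₁ hk₂ hk hx.1 hx.2 hθ'
  have hB : ellIntegrand k₂ θ * (∫ x in θ..(π / 2), ellIntegrand k₁ x) ≤
      (∫ x in θ..(π / 2), ellIntegrand k₂ x) * ellIntegrand k₁ θ := by
    rw [← intervalIntegral.integral_mul_const, ← intervalIntegral.integral_const_mul]
    exact intervalIntegral.integral_mono_on hθ'
      ((intervalIntegrable_ellIntegrand hk₁ _ _).const_mul _)
      ((intervalIntegrable_ellIntegrand hk₂ _ _).mul_const _)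
      fun x hx => ellIntegrand_mul_le hk₁ hk₂ hk hθ hx.1 hx.2
  have hA0 : 0 ≤ incompleteEll k₁ θ := hθ.trans (le_incompleteEll hk₁ hθ)
  have hB0 : 0 ≤ ∫ x in θ..(π / 2), ellIntegrand k₁ x :=
    intervalIntegral.integral_nonneg hθ' fun x _ => (ellIntegrand_pos hk₁ x).le
  rw [← split hk₁, ← split hk₂]
  refine le_of_mul_le_mul_right ?_ (ellIntegrand_pos hk₁ θ)
  nlinarith [mul_le_mul_of_nonneg_right hA hB0, mul_le_mul_of_nonneg_left hB hA0]

lemma ellAmplitude_pos {k : ℝ} (hk : k ∈ Ioo 0 1) : 0 < ellAmplitude k :=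
  arccos_pos.2 (sqrt_amplitude_lt_one hk)

lemma continuousAt_ellAmplitude {k : ℝ} (hk : k ≠ 0) : ContinuousAt ellAmplitude k := by
  unfold ellAmplitude
  refine continuous_arccos.continuousAt.comp (continuous_sqrt.continuousAt.comp ?_)
  exact ContinuousAt.div (by fun_prop) (by fun_prop) (pow_ne_zero 2 hk)

lemma one_div_sqrt_two_pos : 0 < 1 / √2 := by positivity

lemma one_div_sqrt_two_lt_one : 1 / √2 < 1 := by
  rw [div_lt_one (by positivity), lt_sqrt zero_le_one]
  norm_num

lemma mem_Ioo_zero_one {k : ℝ} (hk : k ∈ Ioo (1 / √2) 1) : k ∈ Ioo 0 1 :=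
  ⟨one_div_sqrt_two_pos.trans hk.1, hk.2⟩

lemma two_mul_sq_sub_one_pos {k : ℝ} (hk : k ∈ Ioo (1 / √2) 1) : 0 < 2 * k ^ 2 - 1 := by
  have h := pow_lt_pow_left₀ hk.1 one_div_sqrt_two_pos.le two_ne_zero
  rw [div_pow, sq_sqrt zero_le_two] at h
  linarith

lemma ellAmplitude_lt_pi_div_two {k : ℝ} (hk : k ∈ Ioo (1 / √2) 1) :
    ellAmplitude k < π / 2 := by
  have h0 := (mem_Ioo_zero_one hk).1
  exact arccos_lt_pi_div_two.2 (sqrt_pos.2 (div_pos (two_mul_sq_sub_one_pos hk) (by positivity)))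

lemma ellAmplitude_strictAntiOn : StrictAntiOn ellAmplitude (Ioo (1 / √2) 1) := by
  intro a ha b hb hab
  have ha0 := (mem_Ioo_zero_one ha).1
  have hb0 := (mem_Ioo_zero_one hb).1
  refine arccos_lt_arccos (by linarith [sqrt_nonneg ((2 * a ^ 2 - 1) / a ^ 2)])
    (sqrt_lt_sqrt (div_pos (two_mul_sq_sub_one_pos ha) (by positivity)).le ?_)
    (sqrt_amplitude_lt_one (mem_Ioo_zero_one hb)).le
  rw [div_lt_div_iff₀ (by positivity) (by positivity)]
  nlinarith [pow_lt_pow_left₀ hab ha0.le two_ne_zero]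

lemma ellAmplitude_one_div_sqrt_two : ellAmplitude (1 / √2) = π / 2 := by
  simp [ellAmplitude]

lemma incompleteEll_ellAmplitude_le {k : ℝ} (hk : k ∈ Ioo (1 / √2) 1) :
    incompleteEll k (ellAmplitude k) ≤ ellAmplitude k / k := by
  have hk' := mem_Ioo_zero_one hk
  have hk0 := hk'.1
  have hθ := (ellAmplitude_pos hk').le
  have hsin : sin (ellAmplitude k) ^ 2 = (1 - k ^ 2) / k ^ 2 := by
    rw [ellAmplitude, sin_arccos, sq_sqrt, sq_sqrt]
    · field_simp
      ring
    · exact (div_pos (two_mul_sq_sub_one_pos hk) (by positivity)).le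
    · nlinarith [sqrt_amplitude_lt_one hk', sqrt_nonneg ((2 * k ^ 2 - 1) / k ^ 2)]
  have h := intervalIntegral.integral_mono_on hθ (intervalIntegrable_ellIntegrand hk' _ _)
    (intervalIntegrable_const (c := 1 / k)) fun x hx => ?_
  · rw [intervalIntegral.integral_const, smul_eq_mul, sub_zero, mul_one_div] at h
    exact h
  · refine one_div_le_one_div_of_le hk0 (le_sqrt_of_sq_le ?_)
    have hx2 : sin x ^ 2 ≤ (1 - k ^ 2) / k ^ 2 := hsin ▸ pow_le_pow_left₀
      (sin_nonneg_of_nonneg_of_le_pi hx.1 (by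
        linarith [hx.2, ellAmplitude_lt_pi_div_two hk, pi_pos]))
      (sin_le_sin_of_le_of_le_pi_div_two (by linarith [hx.1, pi_pos])
        (ellAmplitude_lt_pi_div_two hk).le hx.2) 2
    rw [le_div_iff₀ (by positivity)] at hx2
    linarith

lemma continuousAt_phiFun {k : ℝ} (hk : k ∈ Ioo 0 1) : ContinuousAt phiFun k := by
  have hnum : ContinuousAt (fun k => incompleteEll k (ellAmplitude k)) k :=
    ContinuousAt.comp (f := fun k => (k, ellAmplitude k))
      (continuousAt_incompleteEll hk (ellAmplitude k))
      (continuousAt_id.prodMk (continuousAt_ellAmplitude hk.1.ne'))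
  have hden : ContinuousAt (fun k => incompleteEll k (π / 2)) k :=
    ContinuousAt.comp (f := fun k => (k, π / 2))
      (continuousAt_incompleteEll hk (π / 2)) (continuousAt_id.prodMk continuousAt_const)
  refine (hnum.div hden (incompleteEll_pos hk (by positivity)).ne').congr ?_
  filter_upwards [Ioo_mem_nhds hk.1 hk.2] with x hx using (phiFun_eq hx).symm

lemma phiFun_mem_Ioo {k : ℝ} (hk : k ∈ Ioo (1 / √2) 1) : phiFun k ∈ Ioo 0 1 := by
  have hk' := mem_Ioo_zero_one hk
  have hK := incompleteEll_pos hk' (half_pos pi_pos)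
  rw [phiFun_eq hk']
  exact ⟨div_pos (incompleteEll_pos hk' (ellAmplitude_pos hk')) hK,
    (div_lt_one hK).2 (incompleteEll_strictMono hk' (ellAmplitude_lt_pi_div_two hk))⟩

lemma phiFun_strictAntiOn : StrictAntiOn phiFun (Ioo (1 / √2) 1) := by
  intro a ha b hb hab
  have ha' := mem_Ioo_zero_one ha
  have hb' := mem_Ioo_zero_one hb
  have hKa := incompleteEll_pos ha' (half_pos pi_pos)
  have hKb := incompleteEll_pos hb' (half_pos pi_pos)
  rw [phiFun_eq ha', phiFun_eq hb', div_lt_div_iff₀ hKb hKa]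
  calc incompleteEll b (ellAmplitude b) * incompleteEll a (π / 2)
      < incompleteEll b (ellAmplitude a) * incompleteEll a (π / 2) :=
        mul_lt_mul_of_pos_right
          (incompleteEll_strictMono hb' (ellAmplitude_strictAntiOn ha hb hab)) hKa
    _ ≤ incompleteEll a (ellAmplitude a) * incompleteEll b (π / 2) :=
        incompleteEll_mul_le ha' hb' hab.le (ellAmplitude_pos ha').le
          (ellAmplitude_lt_pi_div_two ha).le

lemma tendsto_phiFun_one_div_sqrt_two :
    Tendsto phiFun (nhdsWithin (1 / √2) (Ioo (1 / √2) 1)) (nhds 1) := by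
  have hmem : 1 / √2 ∈ Ioo (0 : ℝ) 1 := ⟨one_div_sqrt_two_pos, one_div_sqrt_two_lt_one⟩
  have h := (continuousAt_phiFun hmem).tendsto
  rw [phiFun_eq hmem, ellAmplitude_one_div_sqrt_two,
    div_self (incompleteEll_pos hmem (half_pos pi_pos)).ne'] at h
  exact h.mono_left nhdsWithin_le_nhds

lemma tendsto_phiFun_one : Tendsto phiFun (nhdsWithin 1 (Ioo (1 / √2) 1)) (nhds 0) := by
  have h : ContinuousAt (fun k => ellAmplitude k / k / (π / 2)) 1 :=
    ((continuousAt_ellAmplitude one_ne_zero).div continuousAt_id one_ne_zero).div_const _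
  have h' : Tendsto (fun k => ellAmplitude k / k / (π / 2)) (nhds 1) (nhds 0) := by
    have h1 : ellAmplitude 1 / 1 / (π / 2) = 0 := by
      norm_num [ellAmplitude]
    exact h1 ▸ h.tendsto
  refine squeeze_zero' ?_ ?_ (h'.mono_left nhdsWithin_le_nhds)
  · filter_upwards [self_mem_nhdsWithin] with k hk using (phiFun_mem_Ioo hk).1.le
  · filter_upwards [self_mem_nhdsWithin] with k hk
    have hk' := mem_Ioo_zero_one hk
    have hk0 := hk'.1
    rw [phiFun_eq hk']
    exact div_le_div₀ (div_pos (ellAmplitude_pos hk') hk0).le (incompleteEll_ellAmplitude_le hk)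
      (half_pos pi_pos) (le_incompleteEll hk' (half_pos pi_pos).le)

/-- φ is continuous and strictly decreasing on (1/√2, 1), with
φ(k) → 1 as k → (1/√2)⁺, φ(k) → 0 as k → 1⁻, and image (0, 1). -/
theorem stmt_4 :
    ContinuousOn phiFun (Set.Ioo (1 / Real.sqrt 2) 1) ∧
    StrictAntiOn phiFun (Set.Ioo (1 / Real.sqrt 2) 1) ∧
    Filter.Tendsto phiFun (nhdsWithin (1 / Real.sqrt 2) (Set.Ioo (1 / Real.sqrt 2) 1)) (nhds 1) ∧
    Filter.Tendsto phiFun (nhdsWithin 1 (Set.Ioo (1 / Real.sqrt 2) 1)) (nhds 0) ∧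
    phiFun '' Set.Ioo (1 / Real.sqrt 2) 1 = Set.Ioo 0 1 := by
  have hcont : ContinuousOn phiFun (Ioo (1 / √2) 1) := fun k hk =>
    (continuousAt_phiFun (mem_Ioo_zero_one hk)).continuousWithinAt
  refine ⟨hcont, phiFun_strictAntiOn, tendsto_phiFun_one_div_sqrt_two, tendsto_phiFun_one,
    Subset.antisymm (image_subset_iff.2 fun k hk => phiFun_mem_Ioo hk) ?_⟩
  have : (nhdsWithin (1 / √2) (Ioo (1 / √2) 1)).NeBot :=
    left_nhdsWithin_Ioo_neBot one_div_sqrt_two_lt_one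
  have : (nhdsWithin 1 (Ioo (1 / √2) 1)).NeBot :=
    right_nhdsWithin_Ioo_neBot one_div_sqrt_two_lt_one
  exact isPreconnected_Ioo.intermediate_value_Ioo
    (l₁ := nhdsWithin 1 _) (l₂ := nhdsWithin (1 / √2) _) inf_le_right inf_le_right hcont
    tendsto_phiFun_one tendsto_phiFun_one_div_sqrt_two
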